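/- Consider a system of first-order ODEs for n + m functions u = (u₁,…,uₙ), v = (v₁,…,v_m): t du_i/dt = t^{μ_i} f_i(t, u, v) and t dv_i/dt = −λ_i v_i + t^{ν_i} g_i(t, u, v), where the constants λ_i are positive, the integers μ_i, ν_i are ≥ 1, and C ⊆ ℝⁿ is an open set such that f and g are analytic in a neighbourhood of (t, u, v) = (0, c, 0) for every c ∈ C. Then there exists an n-parameter family of solutions, defined for all c ∈ C and |t| < t₀(c), such that u_i(t) = c_i + O(t^{μ_i}) and v_i(t) = O(t^{ν_i}), with u and v analytic in t and in c. -/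

import Mathlib

open Real Filter Set Topology Asymptotics

noncomputable section

section Nemytskii

variable {K E F : Type*} [TopologicalSpace K] [CompactSpace K]
  [NormedAddCommGroup E] [NormedSpace ℝ E] [NormedAddCommGroup F] [NormedSpace ℝ F]

/-- A continuous multilinear map acts pointwise on continuous functions. -/
def pointwiseMultilinear (K : Type*) [TopologicalSpace K] [CompactSpace K] {k : ℕ}
    (q : ContinuousMultilinearMap ℝ (fun _ : Fin k => E) F) :
    ContinuousMultilinearMap ℝ (fun _ : Fin k => C(K, E)) C(K, F) :=
  MultilinearMap.mkContinuous
    { toFun := fun φ => ⟨fun s => q fun j => φ j s, by fun_prop⟩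
      map_update_add' := by
        intro _ φ j x y
        ext s
        have key : ∀ z : C(K, E), (fun i => Function.update φ j z i s)
            = Function.update (fun i => φ i s) j (z s) := fun z =>
          funext fun i => Function.apply_update (fun _ (ψ : C(K, E)) => ψ s) φ j z i
        simp only [ContinuousMap.coe_mk, ContinuousMap.add_apply, key]
        have := q.map_update_add (fun i => φ i s) j (x s) (y s)
        convert this
      map_update_smul' := by
        intro _ φ j a x
        ext s
        have key : ∀ z : C(K, E), (fun i => Function.update φ j z i s)
            = Function.update (fun i => φ i s) j (z s) := fun z =>
          funext fun i => Function.apply_update (fun _ (ψ : C(K, E)) => ψ s) φ j z i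
        simp only [ContinuousMap.coe_mk, ContinuousMap.smul_apply, key]
        have := q.map_update_smul (fun i => φ i s) j a (x s)
        convert this }
    ‖q‖ (fun φ => by
      rw [ContinuousMap.norm_le _ (by positivity)]
      intro s
      refine (q.le_opNorm _).trans ?_
      gcongr with j
      exact (φ j).norm_coe_le_norm s)

theorem norm_pointwiseMultilinear_le {k : ℕ}
    (q : ContinuousMultilinearMap ℝ (fun _ : Fin k => E) F) :
    ‖pointwiseMultilinear K q‖ ≤ ‖q‖ :=
  MultilinearMap.mkContinuous_norm_le _ (norm_nonneg _) _

/-- The superposition operator of a map analytic at a point is analytic on continuous functions. -/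
theorem exists_analyticAt_superposition [CompleteSpace F] {h : E → F} {x : E}
    (hh : AnalyticAt ℝ h x) :
    ∃ N : C(K, E) → C(K, F), AnalyticAt ℝ N 0 ∧
      ∀ᶠ φ in 𝓝 0, ∀ s, N φ s = h (x + φ s) := by
  obtain ⟨p, r, hp⟩ := hh
  let q : FormalMultilinearSeries ℝ C(K, E) C(K, F) := fun k => pointwiseMultilinear K (p k)
  have hrad : p.radius ≤ q.radius :=
    FormalMultilinearSeries.radius_le_of_le fun k => norm_pointwiseMultilinear_le (p k)
  have hq := q.hasFPowerSeriesOnBall (hp.r_pos.trans_le (hp.r_le.trans hrad))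
  refine ⟨q.sum, hq.analyticAt, ?_⟩
  filter_upwards [Metric.eball_mem_nhds (0 : C(K, E)) hp.r_pos] with φ hφ s
  have hφ' : φ s ∈ Metric.eball (0 : E) r := by
    rw [mem_eball_zero_iff] at hφ ⊢
    refine lt_of_le_of_lt ?_ hφ
    rw [enorm_le_iff_norm_le]
    exact φ.norm_coe_le_norm s
  have h1 := hp.hasSum hφ'
  have h2 := q.hasSum (x := φ) (Metric.eball_subset_eball (hp.r_le.trans hrad) hφ)
  have h3 := h2.mapL (ContinuousMap.evalCLM ℝ s)
  exact HasSum.unique h3 h1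

end Nemytskii

section FixedPoint

open MeasureTheory unitInterval ContDiff

/-- The operator `ψ ↦ (s ↦ s ^ k * ∫₀¹ τ ^ a * ψ (s * τ) dτ)` on continuous functions on `[0, 1]`. -/
def averagingOperator (k : ℕ) (a : ℝ) (ha : 0 ≤ a) : C(I, ℝ) →L[ℝ] C(I, ℝ) :=
  LinearMap.mkContinuous
    { toFun := fun ψ => ⟨fun s => (s : ℝ) ^ k * ∫ τ : I, (τ : ℝ) ^ a * ψ (s * τ), by
        have h1 : Continuous fun τ : I => (τ : ℝ) ^ a :=
          (Real.continuous_rpow_const ha).comp continuous_subtype_val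
        have h2 : Continuous fun s : I => ∫ τ : I, (τ : ℝ) ^ a * ψ (s * τ) := by
          have := continuous_parametric_integral_of_continuous (μ := (volume : Measure I))
            (f := fun s τ : I => (τ : ℝ) ^ a * ψ (s * τ)) (s := univ)
            (by
              refine (h1.comp continuous_snd).mul ?_
              exact ψ.continuous.comp continuous_mul) isCompact_univ
          simpa using this
        exact (continuous_subtype_val.pow k).mul h2⟩
      map_add' := by
        intro φ ψ
        ext s
        have h1 : Continuous fun τ : I => (τ : ℝ) ^ a :=
          (Real.continuous_rpow_const ha).comp continuous_subtype_val
        have hint : ∀ χ : C(I, ℝ), Integrable fun τ : I => (τ : ℝ) ^ a * χ (s * τ) := fun χ =>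
          (h1.mul (χ.continuous.comp (continuous_const_mul s))).integrable_of_hasCompactSupport
            (HasCompactSupport.of_compactSpace _)
        simp only [ContinuousMap.coe_mk, ContinuousMap.add_apply, mul_add]
        rw [integral_add (hint φ) (hint ψ), mul_add]
      map_smul' := by
        intro b ψ
        ext s
        simp only [ContinuousMap.coe_mk, ContinuousMap.smul_apply, smul_eq_mul, RingHom.id_apply,
          mul_left_comm _ b, integral_const_mul] }
    1 (fun ψ => by
      rw [ContinuousMap.norm_le _ (by positivity), one_mul]
      intro s
      have hI : ‖∫ τ : I, (τ : ℝ) ^ a * ψ (s * τ)‖ ≤ ‖ψ‖ := by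
        have := norm_integral_le_of_norm_le_const (μ := (volume : Measure I)) (C := ‖ψ‖)
          (f := fun τ : I => (τ : ℝ) ^ a * ψ (s * τ)) (Eventually.of_forall fun τ => by
            rw [norm_mul, Real.norm_of_nonneg (Real.rpow_nonneg τ.2.1 _)]
            exact (mul_le_of_le_one_left (norm_nonneg _)
              (Real.rpow_le_one τ.2.1 τ.2.2 ha)).trans (ψ.norm_coe_le_norm _))
        simpa using this
      change ‖(s : ℝ) ^ k * ∫ τ : I, (τ : ℝ) ^ a * ψ (s * τ)‖ ≤ _
      rw [norm_mul, Real.norm_of_nonneg (pow_nonneg s.2.1 _)]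
      exact (mul_le_of_le_one_left (norm_nonneg _) (pow_le_one₀ s.2.1 s.2.2)).trans hI)

theorem averagingOperator_apply (k : ℕ) (a : ℝ) (ha : 0 ≤ a) (ψ : C(I, ℝ)) (s : I) :
    averagingOperator k a ha ψ s = (s : ℝ) ^ k * ∫ τ : I, (τ : ℝ) ^ a * ψ (s * τ) := rfl

variable {P ι : Type*} [NormedAddCommGroup P] [NormedSpace ℝ P] [Fintype ι]

variable (P ι) in
/-- The map sending a parameter `c`, a time scale `ε` and a curve `W` on `[0, 1]` to the curve
`s ↦ (ε * s, c, W s)`. -/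
def rescaledGraph : ((P × ℝ) × (ι → C(I, ℝ))) →L[ℝ] C(I, ℝ × P × (ι → ℝ)) :=
  LinearMap.mkContinuous
    { toFun := fun w => ⟨fun s => (w.1.2 * s, w.1.1, fun i => w.2 i s), by fun_prop⟩
      map_add' := by
        intro w w'
        ext s <;> simp [add_mul]
      map_smul' := by
        intro b w
        ext s <;> simp [mul_assoc] }
    1 (fun w => by
      rw [ContinuousMap.norm_le _ (by positivity), one_mul]
      intro s
      have h1 : ‖w.1.2 * (s : ℝ)‖ ≤ ‖w‖ := by
        rw [norm_mul, Real.norm_of_nonneg s.2.1]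
        exact (mul_le_of_le_one_right (norm_nonneg _) s.2.2).trans
          ((norm_snd_le w.1).trans (norm_fst_le w))
      have h2 : ‖w.1.1‖ ≤ ‖w‖ := (norm_fst_le w.1).trans (norm_fst_le w)
      have h3 : ‖fun i => w.2 i s‖ ≤ ‖w‖ := by
        rw [pi_norm_le_iff_of_nonneg (norm_nonneg _)]
        exact fun i => ((w.2 i).norm_coe_le_norm s).trans
          ((norm_le_pi_norm w.2 i).trans (norm_snd_le w))
      exact norm_prod_le_iff.2 ⟨h1, norm_prod_le_iff.2 ⟨h2, h3⟩⟩)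

theorem rescaledGraph_apply (w : (P × ℝ) × (ι → C(I, ℝ))) (s : I) :
    rescaledGraph P ι w s = (w.1.2 * s, w.1.1, fun i => w.2 i s) := rfl

/-- The parametrized family of solutions, on `[0, 1]`, of the time-rescaled integral equation. -/
theorem exists_rescaled_solution [CompleteSpace P] (κ : ι → ℕ) (lam : ι → ℝ) (hκ : ∀ i, 1 ≤ κ i)
    (hlam : ∀ i, 0 ≤ lam i) (h : ℝ × P × (ι → ℝ) → ι → ℝ) (c₀ : P)
    (hh : AnalyticAt ℝ h (0, c₀, 0)) :
    ∃ (Φ : P × ℝ → ι → C(I, ℝ)) (R r : ℝ), 0 < R ∧ 0 < r ∧ ∀ p ∈ Metric.ball (c₀, (0 : ℝ)) r,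
      AnalyticAt ℝ Φ p ∧ ‖Φ p‖ < R ∧
      (∀ s : I, AnalyticAt ℝ h (p.2 * s, p.1, fun i => Φ p i s)) ∧
      ∀ W : ι → C(I, ℝ), ‖W‖ < R →
        ((∀ i (s : I), W i s = (p.2 * s) ^ κ i * ∫ τ : I, (τ : ℝ) ^ (lam i + κ i - 1) *
          h (p.2 * s * τ, p.1, fun j => W j (s * τ)) i) ↔ Φ p = W) := by
  have ha : ∀ i, 0 ≤ lam i + κ i - 1 := fun i => by
    have : (1 : ℝ) ≤ κ i := by exact_mod_cast hκ i
    linarith [hlam i]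
  have hhi : ∀ i, AnalyticAt ℝ (fun z => h z i) (0, c₀, 0) := fun i => analyticAt_pi_iff.1 hh i
  choose N hN hNe using fun i => exists_analyticAt_superposition (K := I) (hhi i)
  let u : (P × ℝ) × (ι → C(I, ℝ)) := ((c₀, 0), 0)
  let A : (P × ℝ) × (ι → C(I, ℝ)) → C(I, ℝ × P × (ι → ℝ)) := fun w => rescaledGraph P ι (w - u)
  have hAu : A u = 0 := by simp [A]
  have hAan : AnalyticAt ℝ A u := by
    have := (rescaledGraph P ι).analyticAt (u - u)
    exact this.comp_of_eq (analyticAt_id.sub analyticAt_const) rfl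
  have hA : ∀ w s, (((0 : ℝ), c₀, (0 : ι → ℝ)) : ℝ × P × (ι → ℝ)) + A w s
      = (w.1.2 * s, w.1.1, fun i => w.2 i s) := by
    intro w s
    simp only [A, rescaledGraph_apply, u]
    ext <;> simp
  let G : (P × ℝ) × (ι → C(I, ℝ)) → ι → C(I, ℝ) := fun w i =>
    w.2 i - w.1.2 ^ κ i • averagingOperator (κ i) _ (ha i) (N i (A w))
  have hG : AnalyticAt ℝ G u := by
    refine analyticAt_pi_iff.2 fun i => ?_
    have h1 : AnalyticAt ℝ (fun w => N i (A w)) u := (hN i).comp_of_eq hAan hAu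
    have h2 : AnalyticAt ℝ (fun w => averagingOperator (κ i) _ (ha i) (N i (A w))) u :=
      ((averagingOperator (κ i) _ (ha i)).analyticAt _).comp h1
    have h3 : AnalyticAt ℝ (fun w : (P × ℝ) × (ι → C(I, ℝ)) => w.1.2 ^ κ i) u :=
      (analyticAt_snd.comp analyticAt_fst).pow _
    have h4 : AnalyticAt ℝ (fun w : (P × ℝ) × (ι → C(I, ℝ)) => w.2 i) u :=
      ((ContinuousLinearMap.proj (R := ℝ) (φ := fun _ : ι => C(I, ℝ)) i).analyticAt _).comp
        analyticAt_snd
    exact h4.sub (h3.smul h2)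
  have hGu : G u = 0 := by
    ext i s
    have : κ i ≠ 0 := (Nat.lt_of_lt_of_le one_pos (hκ i)).ne'
    simp [G, u, this]
  have hinr : fderiv ℝ G u ∘L .inr ℝ (P × ℝ) (ι → C(I, ℝ)) = .id ℝ _ := by
    have h1 : HasFDerivAt (fun W : ι → C(I, ℝ) => G ((c₀, 0), W))
        (fderiv ℝ G u ∘L .inr ℝ (P × ℝ) (ι → C(I, ℝ))) 0 := by
      have h2 : HasFDerivAt (fun W : ι → C(I, ℝ) => ((c₀, (0 : ℝ)), W))
        (.inr ℝ (P × ℝ) (ι → C(I, ℝ))) 0 := hasFDerivAt_prodMk_right _ _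
      exact hG.differentiableAt.hasFDerivAt.comp (0 : ι → C(I, ℝ)) h2
    have h3 : (fun W : ι → C(I, ℝ) => G ((c₀, 0), W)) = id := by
      ext W i s
      have : κ i ≠ 0 := (Nat.lt_of_lt_of_le one_pos (hκ i)).ne'
      simp [G, this]
    rw [h3] at h1
    exact h1.unique (hasFDerivAt_id _)
  have hinv : (fderiv ℝ G u ∘L .inr ℝ (P × ℝ) (ι → C(I, ℝ))).IsInvertible := by
    rw [hinr]
    exact ⟨.refl ℝ _, rfl⟩
  have cdf : ContDiffAt ℝ ω G u := hG.contDiffAt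
  have hω : (ω : ℕ∞ω) ≠ 0 := by simp
  set Φ := cdf.implicitFunction hω hinv
  have hΦan : AnalyticAt ℝ Φ (c₀, 0) := (cdf.contDiffAt_implicitFunction hω hinv).analyticAt
  have hΦ0 : Φ (c₀, 0) = 0 := cdf.implicitFunction_apply_self hω hinv
  have hA0 : Tendsto A (𝓝 u) (𝓝 0) := hAu ▸ hAan.continuousAt
  have ev1 := cdf.eventually_apply_eq_iff_implicitFunction hω hinv
  have ev2 : ∀ᶠ w in 𝓝 u, ∀ i s, N i (A w) s = h (w.1.2 * s, w.1.1, fun i => w.2 i s) i := by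
    refine eventually_all.2 fun i => ?_
    filter_upwards [hA0.eventually (hNe i)] with w hw s
    rw [hw s, hA]
  have ev3 : ∀ᶠ w in 𝓝 u, ∀ s : I, AnalyticAt ℝ h (w.1.2 * s, w.1.1, fun i => w.2 i s) := by
    obtain ⟨δ, hδ, hball⟩ := Metric.eventually_nhds_iff_ball.1 hh.eventually_analyticAt
    filter_upwards [hA0.eventually (Metric.ball_mem_nhds 0 hδ)] with w hw s
    rw [← hA]
    refine hball _ ?_
    rw [Metric.mem_ball, dist_eq_norm, add_sub_cancel_left]
    replace hw : ‖A w‖ < δ := by simpa using hw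
    exact ((A w).norm_coe_le_norm s).trans_lt hw
  obtain ⟨R, hR, hball⟩ := Metric.eventually_nhds_iff_ball.1 (ev1.and (ev2.and ev3))
  have ev4 : ∀ᶠ p in 𝓝 (c₀, (0 : ℝ)), ‖Φ p‖ < R := by
    have : Tendsto (fun p => ‖Φ p‖) (𝓝 (c₀, 0)) (𝓝 0) := by
      have := hΦan.continuousAt.norm.tendsto
      rwa [hΦ0, norm_zero] at this
    exact this.eventually (gt_mem_nhds hR)
  obtain ⟨r, hr, hball'⟩ := Metric.eventually_nhds_iff_ball.1 (hΦan.eventually_analyticAt.and ev4)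
  have hmem : ∀ p ∈ Metric.ball (c₀, (0 : ℝ)) (min r R), ∀ W : ι → C(I, ℝ), ‖W‖ < R →
      (p, W) ∈ Metric.ball u R := by
    intro p hp W hW
    rw [Metric.mem_ball, Prod.dist_eq, max_lt_iff]
    exact ⟨(Metric.mem_ball.1 hp).trans_le (min_le_right _ _), by simpa [u] using hW⟩
  refine ⟨Φ, R, min r R, hR, lt_min hr hR, fun p hp => ?_⟩
  obtain ⟨h1, h2⟩ := hball' p (Metric.ball_subset_ball (min_le_left _ _) hp)
  refine ⟨h1, h2, (hball _ (hmem p hp _ h2)).2.2, fun W hW => ?_⟩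
  obtain ⟨h3, h4, -⟩ := hball _ (hmem p hp W hW)
  rw [← h3, hGu]
  simp only [funext_iff, DFunLike.ext_iff]
  refine forall_congr' fun i => forall_congr' fun s => ?_
  have h5 : G (p, W) i s = W i s - p.2 ^ κ i * ((s : ℝ) ^ κ i * ∫ τ : I,
      (τ : ℝ) ^ (lam i + κ i - 1) * N i (A (p, W)) (s * τ)) := rfl
  rw [h5]
  simp only [h4, Pi.zero_apply, ContinuousMap.zero_apply, sub_eq_zero, mul_pow, mul_assoc,
    Set.Icc.coe_mul]

end FixedPoint

section IntegralEquation

open MeasureTheory unitInterval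

theorem hasDerivAt_of_eq_pow_mul_integral {y k : ℝ → ℝ} {κ : ℕ} {lam ρ t : ℝ}
    (ha : 0 ≤ lam + κ - 1) (hk : ∀ s, |s| < ρ → ContinuousAt k s)
    (hy : ∀ s, |s| < ρ → y s = s ^ κ * ∫ τ : I, (τ : ℝ) ^ (lam + κ - 1) * k (s * τ))
    (ht : |t| < ρ) (hd : DifferentiableAt ℝ y t) :
    t * deriv y t = -lam * y t + t ^ κ * k t := by
  let q : ℝ → ℝ := fun x => x ^ (lam + κ - 1) * k (t * x)
  have hopen : IsOpen {x : ℝ | |t * x| < ρ} :=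
    isOpen_lt (by fun_prop) continuous_const
  have hq : ContinuousOn q {x : ℝ | |t * x| < ρ} := by
    refine (Real.continuous_rpow_const ha).continuousOn.mul fun x hx => ?_
    exact (ContinuousAt.comp (g := k) (hk _ hx) (by fun_prop)).continuousWithinAt
  have h1mem : (1 : ℝ) ∈ {x : ℝ | |t * x| < ρ} := by simpa using ht
  have hsub : uIcc (0 : ℝ) 1 ⊆ {x : ℝ | |t * x| < ρ} := by
    intro x hx
    rw [uIcc_of_le zero_le_one] at hx
    have : |t * x| ≤ |t| := by
      rw [abs_mul, abs_of_nonneg hx.1]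
      exact mul_le_of_le_one_right (abs_nonneg _) hx.2
    exact this.trans_lt ht
  have hR : HasDerivAt (fun s => t ^ κ * ∫ x in (0 : ℝ)..s, q x) (t ^ κ * q 1) 1 :=
    (intervalIntegral.integral_hasDerivAt_right (hq.mono hsub).intervalIntegrable
      (hq.stronglyMeasurableAtFilter hopen 1 h1mem)
      (hq.continuousAt (hopen.mem_nhds h1mem))).const_mul _
  have hL : HasDerivAt (fun s : ℝ => s ^ lam * y (t * s)) (lam * y t + t * deriv y t) 1 := by
    have e1 : HasDerivAt (fun s : ℝ => s ^ lam) (lam * 1 ^ (lam - 1)) 1 :=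
      Real.hasDerivAt_rpow_const (Or.inl one_ne_zero)
    have e2 : HasDerivAt (fun s : ℝ => t * s) t 1 := by
      simpa using (hasDerivAt_id (1 : ℝ)).const_mul t
    have e3 : HasDerivAt (fun s : ℝ => y (t * s)) (deriv y t * t) 1 := by
      refine HasDerivAt.comp (h₂ := y) (1 : ℝ) ?_ e2
      simpa using hd.hasDerivAt
    refine (e1.mul e3).congr_deriv ?_
    simp [mul_comm]
  have hLR : (fun s : ℝ => s ^ lam * y (t * s)) =ᶠ[𝓝 1]
      fun s => t ^ κ * ∫ x in (0 : ℝ)..s, q x := by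
    filter_upwards [hopen.mem_nhds h1mem, lt_mem_nhds (zero_lt_one (α := ℝ))] with s hs hs0
    have hpre : ∫ τ : I, (τ : ℝ) ^ (lam + κ - 1) * k (t * s * τ)
        = ∫ τ in (0 : ℝ)..1, τ ^ (lam + κ - 1) * k (t * s * τ) := by
      rw [intervalIntegral.integral_of_le zero_le_one, ← integral_Icc_eq_integral_Ioc]
      exact measurePreserving_coe.integral_comp measurableEmbedding_coe
        (fun τ : ℝ => τ ^ (lam + κ - 1) * k (t * s * τ))
    have hsub := intervalIntegral.smul_integral_comp_mul_left (a := 0) (b := 1) q s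
    rw [mul_zero, mul_one] at hsub
    have hq' : ∫ τ in (0 : ℝ)..1, q (s * τ)
        = s ^ (lam + κ - 1) * ∫ τ in (0 : ℝ)..1, τ ^ (lam + κ - 1) * k (t * s * τ) := by
      rw [← intervalIntegral.integral_const_mul]
      refine intervalIntegral.integral_congr fun τ hτ => ?_
      rw [uIcc_of_le zero_le_one] at hτ
      simp only [q]
      rw [Real.mul_rpow hs0.le hτ.1, mul_assoc, mul_assoc]
    have hpow : s ^ lam * s ^ κ = s * s ^ (lam + κ - 1) := by
      rw [← Real.rpow_natCast s κ, ← Real.rpow_add hs0, mul_comm s, ← Real.rpow_add_one hs0.ne']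
      simp
    simp only [hy _ hs, hpre, ← hsub, hq', smul_eq_mul]
    rw [mul_pow, ← mul_assoc s, ← hpow]
    ring
  have := (hL.congr_of_eventuallyEq hLR.symm).unique hR
  simp only [q, Real.one_rpow, one_mul, mul_one] at this
  linarith

theorem isBigO_of_eq_pow_mul_integral {y k : ℝ → ℝ} {κ : ℕ} {a ρ : ℝ}
    (ha : 0 ≤ a) (hρ : 0 < ρ) (hk : ContinuousAt k 0)
    (hy : ∀ s, |s| < ρ → y s = s ^ κ * ∫ τ : I, (τ : ℝ) ^ a * k (s * τ)) :
    y =O[𝓝 0] fun t => t ^ κ := by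
  obtain ⟨η, hη, hbd⟩ := Metric.eventually_nhds_iff_ball.1
    (hk.norm.tendsto.eventually (gt_mem_nhds (lt_add_one ‖k 0‖)))
  refine IsBigO.of_bound (‖k 0‖ + 1) ?_
  filter_upwards [Metric.ball_mem_nhds 0 (lt_min hη hρ)] with t ht
  rw [mem_ball_zero_iff, lt_min_iff] at ht
  rw [hy t ht.2, norm_mul, mul_comm]
  gcongr
  have := norm_integral_le_of_norm_le_const (μ := (volume : Measure I)) (C := ‖k 0‖ + 1)
    (f := fun τ : I => (τ : ℝ) ^ a * k (t * τ)) (Eventually.of_forall fun τ => by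
      rw [norm_mul, Real.norm_of_nonneg (Real.rpow_nonneg τ.2.1 _)]
      refine (mul_le_of_le_one_left (norm_nonneg _) (Real.rpow_le_one τ.2.1 τ.2.2 ha)).trans ?_
      refine (hbd _ ?_).le
      rw [mem_ball_zero_iff, norm_mul, Real.norm_of_nonneg τ.2.1]
      exact (mul_le_of_le_one_right (norm_nonneg _) τ.2.2).trans_lt ht.1)
  simpa using this

variable {P ι : Type*} [NormedAddCommGroup P] [NormedSpace ℝ P] [Fintype ι]

/-- The integral form, at time `t`, of the singular system
`t ẏᵢ = -λᵢ yᵢ + t ^ κᵢ hᵢ(t, c, y)`. -/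
def SolvesIntegralEq (κ : ι → ℕ) (lam : ι → ℝ) (h : ℝ × P × (ι → ℝ) → ι → ℝ) (c : P)
    (y : ℝ → ι → ℝ) (t : ℝ) : Prop :=
  ∀ i, y t i = t ^ κ i * ∫ τ : I, (τ : ℝ) ^ (lam i + κ i - 1) * h (t * τ, c, y (t * τ)) i

theorem exists_local_solution [CompleteSpace P] (κ : ι → ℕ) (lam : ι → ℝ) (hκ : ∀ i, 1 ≤ κ i)
    (hlam : ∀ i, 0 ≤ lam i) (h : ℝ × P × (ι → ℝ) → ι → ℝ) (c₀ : P)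
    (hh : AnalyticAt ℝ h (0, c₀, 0)) :
    ∃ (r : ℝ) (y : P × ℝ → ι → ℝ), 0 < r ∧
      (∀ c ∈ Metric.ball c₀ r, ∀ t, |t| < r → AnalyticAt ℝ y (c, t) ∧
        AnalyticAt ℝ h (t, c, y (c, t)) ∧ SolvesIntegralEq κ lam h c (fun s => y (c, s)) t) ∧
      ∀ c ∈ Metric.ball c₀ r, ∀ (z : ℝ → ι → ℝ) (δ : ℝ), 0 < δ →
        (∀ t, |t| < δ → ContinuousAt z t) → (∀ t, |t| < δ → SolvesIntegralEq κ lam h c z t) →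
        z =ᶠ[𝓝 0] fun t => y (c, t) := by
  obtain ⟨Φ, R, r, hR, hr, H⟩ := exists_rescaled_solution κ lam hκ hlam h c₀ hh
  have hball : ∀ c ∈ Metric.ball c₀ r, ∀ t : ℝ, |t| < r → (c, t) ∈ Metric.ball (c₀, (0 : ℝ)) r := by
    intro c hc t ht
    rw [Metric.mem_ball, Prod.dist_eq, max_lt_iff]
    exact ⟨hc, by simpa using ht⟩
  have hle : ∀ (t : ℝ) (s : I), |t * s| ≤ |t| := by
    intro t s
    rw [abs_mul, abs_of_nonneg s.2.1]
    exact mul_le_of_le_one_right (abs_nonneg _) s.2.2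
  have hscale : ∀ c ∈ Metric.ball c₀ r, ∀ t : ℝ, |t| < r → ∀ s : I, ∀ i,
      Φ (c, t * s) i 1 = Φ (c, t) i s := by
    intro c hc t ht s i
    obtain ⟨-, h1, -, h2⟩ := H _ (hball c hc t ht)
    obtain ⟨-, -, -, h3⟩ := H _ (hball c hc (t * s) ((hle t s).trans_lt ht))
    let W : ι → C(I, ℝ) := fun j => ⟨fun x => Φ (c, t) j (s * x), by fun_prop⟩
    have hW : ‖W‖ < R := by
      refine lt_of_le_of_lt ?_ h1
      rw [pi_norm_le_iff_of_nonneg (norm_nonneg _)]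
      intro j
      rw [ContinuousMap.norm_le _ (norm_nonneg _)]
      exact fun x => ((Φ (c, t) j).norm_coe_le_norm _).trans (norm_le_pi_norm _ j)
    have h4 : Φ (c, t * s) = W := by
      refine (h3 W hW).1 fun j x => ?_
      have := (h2 _ h1).2 rfl j (s * x)
      simpa only [W, ContinuousMap.coe_mk, Set.Icc.coe_mul, mul_assoc] using this
    rw [h4]
    simp [W]
  refine ⟨r, fun p i => Φ p i 1, hr, fun c hc t ht => ?_, fun c hc z δ hδ hz hsol => ?_⟩
  · obtain ⟨h0, h1, h2, h3⟩ := H _ (hball c hc t ht)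
    refine ⟨analyticAt_pi_iff.2 fun i => ?_, ?_, fun i => ?_⟩
    · have h4 := analyticAt_pi_iff.1 h0 i
      exact ((ContinuousMap.evalCLM ℝ (1 : I)).analyticAt _).comp h4
    · simpa using h2 1
    · have := (h3 _ h1).2 rfl i 1
      simpa [hscale c hc t ht] using this
  · have hz0 : z 0 = 0 := by
      ext i
      have hne : κ i ≠ 0 := (Nat.lt_of_lt_of_le one_pos (hκ i)).ne'
      simpa [hne] using hsol 0 (by simpa using hδ) i
    have hc0 : Tendsto (fun t => ‖z t‖) (𝓝 0) (𝓝 0) := by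
      have := (hz 0 (by simpa using hδ)).norm.tendsto
      rwa [hz0, norm_zero] at this
    obtain ⟨η, hη, hbd⟩ := Metric.eventually_nhds_iff_ball.1
      (hc0.eventually (gt_mem_nhds (half_pos hR)))
    filter_upwards [Metric.ball_mem_nhds 0 (lt_min hη (lt_min hδ hr))] with t ht
    rw [mem_ball_zero_iff, lt_min_iff, lt_min_iff, Real.norm_eq_abs] at ht
    obtain ⟨htη, htδ, htr⟩ := ht
    obtain ⟨-, -, -, h3⟩ := H _ (hball c hc t htr)
    let W : ι → C(I, ℝ) := fun j => ⟨fun s => z (t * s) j, by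
      refine continuous_iff_continuousAt.2 fun s => ?_
      have h1 := hz (t * s) ((hle t s).trans_lt htδ)
      have h2 : ContinuousAt (fun s : I => z (t * s)) s :=
        ContinuousAt.comp (g := z) h1 (by fun_prop)
      exact continuousAt_pi.1 h2 j⟩
    have hW : ‖W‖ < R := by
      refine lt_of_le_of_lt ?_ (half_lt_self hR)
      rw [pi_norm_le_iff_of_nonneg (half_pos hR).le]
      intro j
      rw [ContinuousMap.norm_le _ (half_pos hR).le]
      intro s
      refine (norm_le_pi_norm (z (t * s)) j).trans (hbd _ ?_).le
      rw [mem_ball_zero_iff, Real.norm_eq_abs]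
      exact (hle t s).trans_lt htη
    have h4 : Φ (c, t) = W := by
      refine (h3 W hW).1 fun j s => ?_
      have := hsol (t * s) ((hle t s).trans_lt htδ) j
      simpa only [W, ContinuousMap.coe_mk, Set.Icc.coe_mul, mul_assoc] using this
    ext i
    simp [h4, W]

/-- The local families of solutions glue to a single family over the whole parameter set. -/
theorem exists_solution_family [CompleteSpace P] (κ : ι → ℕ) (lam : ι → ℝ) (hκ : ∀ i, 1 ≤ κ i)
    (hlam : ∀ i, 0 ≤ lam i) (h : ℝ × P × (ι → ℝ) → ι → ℝ) (C : Set P)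
    (hh : ∀ c ∈ C, AnalyticAt ℝ h (0, c, 0)) :
    ∃ (r : P → ℝ) (y : P × ℝ → ι → ℝ), ∀ c ∈ C, 0 < r c ∧ ∀ t, |t| < r c →
      AnalyticAt ℝ y (c, t) ∧ AnalyticAt ℝ h (t, c, y (c, t)) ∧
        SolvesIntegralEq κ lam h c (fun s => y (c, s)) t := by
  classical
  choose! r y hr hy huniq using
    fun c hc => exists_local_solution κ lam hκ hlam h c (hh c hc)
  have hslice : ∀ c₀ ∈ C, ∀ c ∈ Metric.ball c₀ (r c₀), ∀ t, |t| < r c₀ →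
      AnalyticAt ℝ (fun s => y c₀ (c, s)) t := fun c₀ h₀ c hc t ht =>
    ((hy c₀ h₀ c hc t ht).1).comp (f := fun s : ℝ => (c, s))
      (analyticAt_const.prod analyticAt_id)
  have hcons : ∀ c₀ ∈ C, ∀ c₁ ∈ C, ∀ c ∈ Metric.ball c₀ (r c₀), c ∈ Metric.ball c₁ (r c₁) →
      ∀ t, |t| < r c₀ → |t| < r c₁ → y c₀ (c, t) = y c₁ (c, t) := by
    intro c₀ h₀ c₁ h₁ c hc₀ hc₁ t ht₀ ht₁
    have hev := huniq c₁ h₁ c hc₁ (fun s => y c₀ (c, s)) (r c₀) (hr c₀ h₀)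
      (fun s hs => (hslice c₀ h₀ c hc₀ s hs).continuousAt)
      (fun s hs => (hy c₀ h₀ c hc₀ s hs).2.2)
    let m := min (r c₀) (r c₁)
    have hm : 0 < m := lt_min (hr c₀ h₀) (hr c₁ h₁)
    have hmem : ∀ s ∈ Ioo (-m) m, |s| < r c₀ ∧ |s| < r c₁ := fun s hs =>
      lt_min_iff.1 (abs_lt.2 hs)
    exact AnalyticOnNhd.eqOn_of_preconnected_of_eventuallyEq (U := Ioo (-m) m) (z₀ := 0)
      (fun s hs => hslice c₀ h₀ c hc₀ s (hmem s hs).1)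
      (fun s hs => hslice c₁ h₁ c hc₁ s (hmem s hs).2)
      isPreconnected_Ioo ⟨neg_lt_zero.2 hm, hm⟩ hev (abs_lt.1 (lt_min ht₀ ht₁))
  let Q : P × ℝ → P → Prop := fun p c₀ => c₀ ∈ C ∧ p.1 ∈ Metric.ball c₀ (r c₀) ∧ |p.2| < r c₀
  let Y : P × ℝ → ι → ℝ := fun p => if H : ∃ c₀, Q p c₀ then y H.choose p else 0
  have hY : ∀ p c₀, Q p c₀ → Y p = y c₀ p := by
    intro p c₀ hp
    have H : ∃ c₀, Q p c₀ := ⟨c₀, hp⟩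
    have hch := H.choose_spec
    have : Y p = y H.choose p := dif_pos H
    rw [this]
    exact hcons _ hch.1 _ hp.1 p.1 hch.2.1 hp.2.1 p.2 hch.2.2 hp.2.2
  refine ⟨r, Y, fun c hc => ⟨hr c hc, fun t ht => ?_⟩⟩
  have hcc : c ∈ Metric.ball c (r c) := Metric.mem_ball_self (hr c hc)
  obtain ⟨h1, h2, h3⟩ := hy c hc c hcc t ht
  have hYc : ∀ s, |s| < r c → Y (c, s) = y c (c, s) := fun s hs => hY _ c ⟨hc, hcc, hs⟩
  refine ⟨h1.congr ?_, ?_, fun i => ?_⟩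
  · have hopen : IsOpen {p : P × ℝ | p.1 ∈ Metric.ball c (r c) ∧ |p.2| < r c} :=
      (Metric.isOpen_ball.preimage continuous_fst).inter
        (isOpen_lt continuous_snd.abs continuous_const)
    filter_upwards [hopen.mem_nhds ⟨hcc, ht⟩] with p hp
    exact (hY p c ⟨hc, hp.1, hp.2⟩).symm
  · rwa [hYc t ht]
  · have hle : ∀ s : I, |t * s| < r c := fun s => by
      refine lt_of_le_of_lt ?_ ht
      rw [abs_mul, abs_of_nonneg s.2.1]
      exact mul_le_of_le_one_right (abs_nonneg _) s.2.2
    simpa only [hYc _ ht, hYc _ (hle _)] using h3 i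

end IntegralEquation

/-- The Breitenlohner–Forgács–Maison theorem: for the singular system
`t u̇ᵢ = t^{μᵢ} fᵢ(t,u,v)`, `t v̇ᵢ = -λᵢ vᵢ + t^{νᵢ} gᵢ(t,u,v)` with `λᵢ > 0`,
`μᵢ, νᵢ ≥ 1` and `f, g` analytic near `(0, c, 0)` for every `c` in an open set
`C ⊆ ℝⁿ`, there is an `n`-parameter family of solutions, defined for `c ∈ C`
and `|t| < t₀(c)`, analytic in `t` and `c`, with `uᵢ(t) = cᵢ + O(t^{μᵢ})` and
`vᵢ(t) = O(t^{νᵢ})`. -/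
theorem bfm (n m : ℕ) (μ : Fin n → ℕ) (ν : Fin m → ℕ) (lam : Fin m → ℝ)
    (hμ : ∀ i, 1 ≤ μ i) (hν : ∀ i, 1 ≤ ν i) (hlam : ∀ i, 0 < lam i)
    (C : Set (Fin n → ℝ)) (hC : IsOpen C)
    (f : ℝ × (Fin n → ℝ) × (Fin m → ℝ) → Fin n → ℝ)
    (g : ℝ × (Fin n → ℝ) × (Fin m → ℝ) → Fin m → ℝ)
    (hf : ∀ c ∈ C, AnalyticAt ℝ f (0, c, 0))
    (hg : ∀ c ∈ C, AnalyticAt ℝ g (0, c, 0)) :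
    ∃ (t₀ : (Fin n → ℝ) → ℝ) (u : (Fin n → ℝ) → ℝ → Fin n → ℝ)
      (v : (Fin n → ℝ) → ℝ → Fin m → ℝ),
      ∀ c ∈ C,
        0 < t₀ c ∧
        u c 0 = c ∧ v c 0 = 0 ∧
        (∀ t, |t| < t₀ c → ∀ i,
          t * deriv (fun s => u c s i) t = t ^ μ i * f (t, u c t, v c t) i) ∧
        (∀ t, |t| < t₀ c → ∀ i,
          t * deriv (fun s => v c s i) t
            = -lam i * v c t i + t ^ ν i * g (t, u c t, v c t) i) ∧
        (∀ i, (fun t => u c t i - c i) =O[𝓝 0] fun t => t ^ μ i) ∧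
        (∀ i, (fun t => v c t i) =O[𝓝 0] fun t => t ^ ν i) ∧
        (∀ t, |t| < t₀ c →
          AnalyticAt ℝ (fun p : (Fin n → ℝ) × ℝ => u p.1 p.2) (c, t) ∧
          AnalyticAt ℝ (fun p : (Fin n → ℝ) × ℝ => v p.1 p.2) (c, t)) := by
  let P : (ℝ × (Fin n → ℝ) × (Fin n ⊕ Fin m → ℝ)) → ℝ × (Fin n → ℝ) × (Fin m → ℝ) :=
    fun z => (z.1, fun i => z.2.1 i + z.2.2 (.inl i), fun j => z.2.2 (.inr j))
  let h : ℝ × (Fin n → ℝ) × (Fin n ⊕ Fin m → ℝ) → Fin n ⊕ Fin m → ℝ :=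
    fun z => Sum.elim (f (P z)) (g (P z))
  let κ : Fin n ⊕ Fin m → ℕ := Sum.elim μ ν
  let l : Fin n ⊕ Fin m → ℝ := Sum.elim 0 lam
  have hP : ∀ z, AnalyticAt ℝ P z := by
    intro z
    have e1 : ∀ i, AnalyticAt ℝ
        (fun z : ℝ × (Fin n → ℝ) × (Fin n ⊕ Fin m → ℝ) => z.2.1 i) z := fun i =>
      (ContinuousLinearMap.proj (R := ℝ) i ∘L .fst ℝ _ _ ∘L .snd ℝ _ _).analyticAt z
    have e2 : ∀ k, AnalyticAt ℝ
        (fun z : ℝ × (Fin n → ℝ) × (Fin n ⊕ Fin m → ℝ) => z.2.2 k) z := fun k =>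
      (ContinuousLinearMap.proj (R := ℝ) k ∘L .snd ℝ _ _ ∘L .snd ℝ _ _).analyticAt z
    exact analyticAt_fst.prod ((analyticAt_pi_iff.2 fun i => (e1 i).add (e2 (.inl i))).prod
      (analyticAt_pi_iff.2 fun j => e2 (.inr j)))
  have hP0 : ∀ c, P (0, c, 0) = (0, c, 0) := by
    intro c
    simp only [P, Pi.zero_apply, add_zero]
    rfl
  have hκ : ∀ k, 1 ≤ κ k := by rintro (i | j); exacts [hμ i, hν j]
  have hl : ∀ k, 0 ≤ l k := by rintro (i | j); exacts [le_rfl, (hlam j).le]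
  have ha : ∀ k, 0 ≤ l k + κ k - 1 := fun k => by
    have : (1 : ℝ) ≤ κ k := by exact_mod_cast hκ k
    linarith [hl k]
  have hh : ∀ c ∈ C, AnalyticAt ℝ h (0, c, 0) := by
    intro c hc
    refine analyticAt_pi_iff.2 ?_
    rintro (i | j)
    · exact analyticAt_pi_iff.1 ((hf c hc).comp_of_eq (hP _) (hP0 c)) i
    · exact analyticAt_pi_iff.1 ((hg c hc).comp_of_eq (hP _) (hP0 c)) j
  obtain ⟨t₀, y, hy⟩ := exists_solution_family κ l hκ hl h C hh
  refine ⟨t₀, fun c t i => c i + y (c, t) (.inl i), fun c t j => y (c, t) (.inr j),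
    fun c hc => ?_⟩
  obtain ⟨ht₀, H⟩ := hy c hc
  have hya : ∀ t, |t| < t₀ c → AnalyticAt ℝ (fun s => y (c, s)) t := fun t ht =>
    ((H t ht).1).comp (f := fun s : ℝ => (c, s)) (analyticAt_const.prod analyticAt_id)
  have hkc : ∀ k t, |t| < t₀ c → ContinuousAt (fun s => h (s, c, y (c, s)) k) t := by
    intro k t ht
    have e : AnalyticAt ℝ (fun s => h (s, c, y (c, s))) t :=
      (H t ht).2.1.comp (f := fun s : ℝ => (s, c, y (c, s)))
        (analyticAt_id.prod (analyticAt_const.prod (hya t ht)))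
    exact (analyticAt_pi_iff.1 e k).continuousAt
  have heq : ∀ k t, |t| < t₀ c → y (c, t) k = t ^ κ k * ∫ τ : unitInterval,
      (τ : ℝ) ^ (l k + κ k - 1) * h (t * τ, c, y (c, t * τ)) k := fun k t ht => (H t ht).2.2 k
  have hode : ∀ k t, |t| < t₀ c → t * deriv (fun s => y (c, s) k) t
      = -l k * y (c, t) k + t ^ κ k * h (t, c, y (c, t)) k := fun k t ht =>
    hasDerivAt_of_eq_pow_mul_integral (k := fun s => h (s, c, y (c, s)) k) (ha k) (hkc k)
      (heq k) ht (analyticAt_pi_iff.1 (hya t ht) k).differentiableAt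
  have hbig : ∀ k, (fun t => y (c, t) k) =O[𝓝 0] fun t => t ^ κ k := fun k =>
    isBigO_of_eq_pow_mul_integral (k := fun s => h (s, c, y (c, s)) k) (ha k) ht₀
      (hkc k 0 (by simpa using ht₀)) (heq k)
  have hy0 : ∀ k, y (c, 0) k = 0 := fun k => by
    have hne : κ k ≠ 0 := (Nat.lt_of_lt_of_le one_pos (hκ k)).ne'
    rw [heq k 0 (by simpa using ht₀), zero_pow hne, zero_mul]
  refine ⟨ht₀, ?_, ?_, fun t ht i => ?_, fun t ht j => hode (.inr j) t ht, fun i => ?_,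
    fun j => hbig (.inr j), fun t ht => ⟨?_, ?_⟩⟩
  · ext i
    simp [hy0]
  · ext j
    simp [hy0]
  · have e := hode (.inl i) t ht
    simp only [l, Sum.elim_inl, Pi.zero_apply, neg_zero, zero_mul, zero_add] at e
    rw [deriv_const_add]
    exact e
  · simp only [add_sub_cancel_left]
    exact hbig (.inl i)
  · refine analyticAt_pi_iff.2 fun i => ?_
    have e1 : AnalyticAt ℝ (fun p : (Fin n → ℝ) × ℝ => p.1 i) (c, t) :=
      (ContinuousLinearMap.proj (R := ℝ) (φ := fun _ : Fin n => ℝ) i ∘L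
        .fst ℝ (Fin n → ℝ) ℝ).analyticAt (c, t)
    exact e1.add (analyticAt_pi_iff.1 (H t ht).1 (.inl i))
  · exact analyticAt_pi_iff.2 fun j => analyticAt_pi_iff.1 (H t ht).1 (.inr j)
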